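/- Let k be a field, let d < n be nonnegative integers, and let a_0, a_1, …, a_{n−1} ∈ ℕ. Then the extension of L(a_0, a_1, …, a_{n−1}) ⊆ k[x_0,…,x_n] along the inclusion k[x_0,…,x_n] ↪ k[x_0,…,x_{n+1}] equals L(0, a_0, a_1, …, a_{n−1}) ⊆ k[x_0,…,x_{n+1}]. Moreover, if the Hilbert polynomial of k[x_0,…,x_n]/L(a_0,…,a_{n−1}) has Gotzmann partition (b_1,…,b_r), then the Hilbert polynomial of k[x_0,…,x_{n+1}]/L(0,a_0,…,a_{n−1}) is Σ_{j=1}^r C(t + (b_j+1) − (j−1), b_j+1). -/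

import Mathlib

/-- The polynomial binomial coefficient `C(t+a, b) ∈ ℚ[t]`. -/
noncomputable def polyBinom (a b : ℤ) : Polynomial ℚ :=
  if 0 ≤ b then
    (Nat.factorial b.toNat : ℚ)⁻¹ •
      (descPochhammer ℚ b.toNat).comp (Polynomial.X + Polynomial.C (a : ℚ))
  else 0

/-- The Gotzmann expression `Σ_{j=1}^r C(t + b_j − (j−1), b_j)`. -/
noncomputable def gotzmannSum (r : ℕ) (b : Fin r → ℤ) : Polynomial ℚ :=
  ∑ j : Fin r, polyBinom (b j - ((j : ℕ) : ℤ)) (b j)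

/-- The Hilbert function of `k[x_0,…,x_{N−1}]/I` in degree `i`: the `k`-dimension of the
degree-`i` homogeneous piece modulo the degree-`i` part of `I`. -/
noncomputable def hilbFn {k : Type*} [Field k] {N : ℕ} (I : Ideal (MvPolynomial (Fin N) k))
    (i : ℕ) : ℕ :=
  Module.finrank k
    ((MvPolynomial.homogeneousSubmodule (Fin N) k i) ⧸
      (Submodule.comap (MvPolynomial.homogeneousSubmodule (Fin N) k i).subtype
        (Submodule.restrictScalars k I)))

/-- The exponent vector of the `m`-th generator (for `0 ≤ m ≤ n−1`) of `L(a_0,…,a_{n−1})`: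
for `m < n−1` it is `x_0^{a_{n−1}}⋯x_{m−1}^{a_{n−m}}·x_m^{a_{n−1−m}+1}`, and for
`m = n−1` it is `x_0^{a_{n−1}}⋯x_{n−2}^{a_1}·x_{n−1}^{a_0}`. -/
noncomputable def lexExp (n : ℕ) (a : ℕ → ℕ) (m : ℕ) : Fin (n + 1) →₀ ℕ :=
  Finsupp.equivFunOnFinite.symm fun t : Fin (n + 1) =>
    if (t : ℕ) < m then a (n - 1 - (t : ℕ))
    else if (t : ℕ) = m then (if m = n - 1 then a 0 else a (n - 1 - m) + 1)
    else 0

/-- The monomial ideal `L(a_0,…,a_{n−1}) ⊆ k[x_0,…,x_n]`. -/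
noncomputable def lexIdealGen (k : Type*) [Field k] (n : ℕ) (a : ℕ → ℕ) :
    Ideal (MvPolynomial (Fin (n + 1)) k) :=
  Ideal.span ((fun m => MvPolynomial.monomial (lexExp n a m) (1 : k)) '' {m : ℕ | m < n})

/-- The Gotzmann expression of a list of natural numbers, defined recursively from the head. -/
noncomputable def gotzmannPoly : List ℕ → Polynomial ℚ
  | [] => 0
  | b :: l => polyBinom b b + Polynomial.taylor (-1) (gotzmannPoly l)

theorem taylor_polyBinom (a b : ℤ) :
    Polynomial.taylor (-1) (polyBinom a b) = polyBinom (a - 1) b := by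
  unfold polyBinom
  split_ifs
  · rw [map_smul, Polynomial.taylor_apply, Polynomial.comp_assoc]
    congr 2
    simp only [Polynomial.add_comp, Polynomial.X_comp, Polynomial.C_comp, add_assoc,
      ← Polynomial.C_add]
    push_cast
    congr 2
    ring
  · simp

theorem sum_polyBinom_eq_gotzmannPoly (r : ℕ) (b : Fin r → ℕ) :
    ∑ j : Fin r, polyBinom ((b j : ℤ) - ((j : ℕ) : ℤ)) (b j) =
      gotzmannPoly (List.ofFn b) := by
  induction r with
  | zero => simp [gotzmannPoly]
  | succ r ih =>
    rw [Fin.sum_univ_succ, List.ofFn_succ, gotzmannPoly, ← ih, map_sum]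
    refine congrArg₂ _ (by simp) (Finset.sum_congr rfl fun j _ => ?_)
    · rw [taylor_polyBinom]
      congr 1
      push_cast [Fin.val_succ]
      ring

theorem eval_polyBinom_natCast (b i : ℕ) :
    (polyBinom b b).eval (i : ℚ) = (i + b).choose b := by
  simp only [polyBinom, Int.natCast_nonneg, if_true, Int.toNat_natCast, Polynomial.eval_smul,
    Polynomial.eval_comp, Polynomial.eval_add, Polynomial.eval_X, Polynomial.eval_C,
    Int.cast_natCast]
  rw [← Nat.cast_add, descPochhammer_eval_eq_descFactorial,
    Nat.descFactorial_eq_factorial_mul_choose, Nat.cast_mul, smul_eq_mul,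
    inv_mul_cancel_left₀ (by positivity)]

theorem natDegree_polyBinom_le (b : ℕ) : (polyBinom b b).natDegree ≤ b := by
  simp only [polyBinom, Int.natCast_nonneg, if_true, Int.toNat_natCast]
  refine (Polynomial.natDegree_smul_le _ _).trans ?_
  rw [Polynomial.natDegree_comp, descPochhammer_natDegree, Polynomial.natDegree_X_add_C, mul_one]

theorem coeff_polyBinom_pos (b : ℕ) : 0 < (polyBinom b b).coeff b := by
  simp only [polyBinom, Int.natCast_nonneg, if_true, Int.toNat_natCast, Polynomial.coeff_smul]
  have h : ((descPochhammer ℚ b).comp (Polynomial.X + Polynomial.C ((b : ℤ) : ℚ))).coeff b = 1 := by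
    have hm := (monic_descPochhammer ℚ b).comp_X_add_C ((b : ℤ) : ℚ)
    have hd : ((descPochhammer ℚ b).comp
        (Polynomial.X + Polynomial.C ((b : ℤ) : ℚ))).natDegree = b := by
      rw [Polynomial.natDegree_comp, descPochhammer_natDegree, Polynomial.natDegree_X_add_C,
        mul_one]
    rw [Polynomial.Monic, Polynomial.leadingCoeff, hd] at hm
    exact hm
  rw [h]
  positivity

theorem coeff_taylor_of_natDegree_le {p : Polynomial ℚ} {b : ℕ} (x : ℚ) (h : p.natDegree ≤ b) :
    (Polynomial.taylor x p).coeff b = p.coeff b := by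
  rcases h.eq_or_lt with rfl | hlt
  · rw [Polynomial.coeff_taylor_natDegree, Polynomial.leadingCoeff]
  · rw [Polynomial.coeff_eq_zero_of_natDegree_lt (by rwa [Polynomial.natDegree_taylor]),
      Polynomial.coeff_eq_zero_of_natDegree_lt hlt]

theorem gotzmannPoly_natDegree_le_and_coeff_nonneg (b : ℕ) (l : List ℕ) (hl : ∀ c ∈ l, c ≤ b) :
    (gotzmannPoly l).natDegree ≤ b ∧ 0 ≤ (gotzmannPoly l).coeff b := by
  induction l with
  | nil => simp [gotzmannPoly]
  | cons c l ih =>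
    obtain ⟨h1, h2⟩ := ih fun x hx => hl x (List.mem_cons_of_mem _ hx)
    have hc : c ≤ b := hl c List.mem_cons_self
    refine ⟨Polynomial.natDegree_add_le_of_degree_le ((natDegree_polyBinom_le c).trans hc)
      (by rwa [Polynomial.natDegree_taylor]), ?_⟩
    rw [gotzmannPoly, Polynomial.coeff_add]
    refine add_nonneg ?_ ?_
    · rcases hc.eq_or_lt with rfl | hlt
      · exact (coeff_polyBinom_pos c).le
      · rw [Polynomial.coeff_eq_zero_of_natDegree_lt ((natDegree_polyBinom_le c).trans_lt hlt)]
    · rwa [coeff_taylor_of_natDegree_le _ h1]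

theorem gotzmannPoly_cons_natDegree_and_ne_zero (b : ℕ) (l : List ℕ) (hl : ∀ c ∈ l, c ≤ b) :
    (gotzmannPoly (b :: l)).natDegree = b ∧ gotzmannPoly (b :: l) ≠ 0 := by
  have h1 := (gotzmannPoly_natDegree_le_and_coeff_nonneg b (b :: l) (by simpa using hl)).1
  obtain ⟨h2, h3⟩ := gotzmannPoly_natDegree_le_and_coeff_nonneg b l hl
  have h4 : 0 ≤ (Polynomial.taylor (-1) (gotzmannPoly l)).coeff b := by
    rwa [coeff_taylor_of_natDegree_le _ h2]
  have h5 : (gotzmannPoly (b :: l)).coeff b ≠ 0 := by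
    rw [gotzmannPoly, Polynomial.coeff_add]
    exact (add_pos_of_pos_of_nonneg (coeff_polyBinom_pos b) h4).ne'
  refine ⟨Polynomial.natDegree_eq_of_le_of_coeff_ne_zero h1 h5, fun h => h5 (by simp [h])⟩

/-- Uniqueness of the Gotzmann partition. -/
theorem gotzmannPoly_injOn (l l' : List ℕ) (hl : l.Pairwise (· ≥ ·)) (hl' : l'.Pairwise (· ≥ ·))
    (h : gotzmannPoly l = gotzmannPoly l') : l = l' := by
  induction l generalizing l' with
  | nil =>
    cases l' with
    | nil => rfl
    | cons b l' => exact absurd h.symm (gotzmannPoly_cons_natDegree_and_ne_zero b l' (List.pairwise_cons.1 hl').1).2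
  | cons b l ih =>
    have hb := gotzmannPoly_cons_natDegree_and_ne_zero b l (List.pairwise_cons.1 hl).1
    cases l' with
    | nil => exact absurd h hb.2
    | cons c l' =>
      have hc := gotzmannPoly_cons_natDegree_and_ne_zero c l' (List.pairwise_cons.1 hl').1
      obtain rfl : b = c := by rw [← hb.1, ← hc.1, h]
      simp only [gotzmannPoly, add_right_inj] at h
      rw [ih l' (List.pairwise_cons.1 hl).2 (List.pairwise_cons.1 hl').2
        (Polynomial.taylor_injective _ h)]

/-- The Gotzmann partition attached to `a_0, …, a_{n-1}`: the value `j` occurs `a_j` times. -/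
def lexPartition (a : ℕ → ℕ) : ℕ → List ℕ
  | 0 => []
  | n + 1 => List.replicate (a n) n ++ lexPartition a n

theorem lt_of_mem_lexPartition (a : ℕ → ℕ) (n c : ℕ) (h : c ∈ lexPartition a n) : c < n := by
  induction n with
  | zero => simp [lexPartition] at h
  | succ n ih =>
    simp only [lexPartition, List.mem_append, List.mem_replicate] at h
    rcases h with ⟨-, rfl⟩ | h
    · omega
    · have := ih h
      omega

theorem lexPartition_pairwise (a : ℕ → ℕ) (n : ℕ) : (lexPartition a n).Pairwise (· ≥ ·) := by
  induction n with
  | zero => simp [lexPartition]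
  | succ n ih =>
    refine List.pairwise_append.2 ⟨List.pairwise_replicate.2 (Or.inr le_rfl), ih, ?_⟩
    intro x hx y hy
    rw [(List.mem_replicate.1 hx).2]
    exact (lt_of_mem_lexPartition a n y hy).le

theorem lexPartition_shift (a : ℕ → ℕ) (n : ℕ) :
    lexPartition (fun j => if j = 0 then 0 else a (j - 1)) (n + 1) =
      (lexPartition a n).map (· + 1) := by
  induction n with
  | zero => simp [lexPartition]
  | succ n ih =>
    rw [lexPartition, ih, lexPartition]
    simp

/-- The exponents of degree `i` not divisible by a generator of `L(a_0,…,a_{n-1})`. -/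
def lexStd (n : ℕ) (a : ℕ → ℕ) (i : ℕ) : Set (Fin (n + 1) →₀ ℕ) :=
  {e | e.degree = i ∧ ∀ m < n, ¬ lexExp n a m ≤ e}

theorem finite_lexStd (n : ℕ) (a : ℕ → ℕ) (i : ℕ) : (lexStd n a i).Finite :=
  (Finsupp.finite_of_degree_eq i).subset fun _ h => h.1

theorem hilbFn_lexIdealGen (k : Type*) [Field k] (n : ℕ) (a : ℕ → ℕ) (i : ℕ) :
    hilbFn (lexIdealGen k n a) i = (lexStd n a i).ncard := by
  classical
  have : Fintype (lexStd n a i) := (finite_lexStd n a i).fintype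
  let φ : MvPolynomial.homogeneousSubmodule (Fin (n + 1)) k i →ₗ[k] (lexStd n a i → k) :=
    (LinearMap.pi fun e => MvPolynomial.lcoeff k e.1) ∘ₗ Submodule.subtype _
  have hφ (f e) : φ f e = MvPolynomial.coeff e.1 f.1 := rfl
  have hs : Function.Surjective φ := by
    intro g
    refine ⟨⟨∑ e, MvPolynomial.monomial e.1 (g e), Submodule.sum_mem _ fun e _ =>
      MvPolynomial.isHomogeneous_monomial _ e.2.1⟩, ?_⟩
    ext e
    rw [hφ]
    simp [MvPolynomial.coeff_sum, MvPolynomial.coeff_monomial, Subtype.coe_inj]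
  have hk : Submodule.comap (MvPolynomial.homogeneousSubmodule (Fin (n + 1)) k i).subtype
      (Submodule.restrictScalars k (lexIdealGen k n a)) = LinearMap.ker φ := by
    ext f
    rw [Submodule.mem_comap, Submodule.restrictScalars_mem, LinearMap.mem_ker, lexIdealGen,
      ← Set.image_image (fun s => MvPolynomial.monomial s (1 : k)),
      MvPolynomial.mem_ideal_span_monomial_image]
    constructor
    · intro h
      ext e
      rw [hφ]
      by_contra hne
      obtain ⟨s, ⟨m, hm, rfl⟩, hle⟩ := h e.1 (MvPolynomial.mem_support_iff.2 hne)
      exact e.2.2 m hm hle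
    · intro h e he
      by_contra hcon
      push Not at hcon
      refine MvPolynomial.mem_support_iff.1 he (congr_fun h ⟨e, ?_, fun m hm =>
        hcon _ ⟨m, hm, rfl⟩⟩)
      have := f.2 (MvPolynomial.mem_support_iff.1 he)
      rw [Finsupp.degree_eq_weight_one]
      exact this
  rw [hilbFn, hk, (φ.quotKerEquivOfSurjective hs).finrank_eq, Module.finrank_fintype_fun_eq_card,
    ← Nat.card_eq_fintype_card]
  rfl

/-- Splitting a finite set of exponents according to whether the first variable occurs. -/
theorem ncard_exponents_split {n : ℕ} {S : Set (Fin (n + 1) →₀ ℕ)} (hS : S.Finite) :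
    S.ncard = {e : Fin n →₀ ℕ | Finsupp.cons 0 e ∈ S}.ncard +
      {e : Fin (n + 1) →₀ ℕ | e + Finsupp.single 0 1 ∈ S}.ncard := by
  rw [← Set.ncard_image_of_injective {e : Fin n →₀ ℕ | Finsupp.cons 0 e ∈ S}
      (Finsupp.cons_right_injective (0 : ℕ)),
    ← Set.ncard_image_of_injective {e | e + Finsupp.single 0 1 ∈ S}
      (add_left_injective (Finsupp.single (0 : Fin (n + 1)) 1)),
    ← Set.ncard_union_eq ?_ (hS.subset (by rintro _ ⟨e, he, rfl⟩; exact he))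
      (hS.subset (by rintro _ ⟨e, he, rfl⟩; exact he))]
  · congr 1
    ext e
    constructor
    · intro he
      rcases Nat.eq_zero_or_pos (e 0) with h | h
      · have hc : Finsupp.cons 0 e.tail = e := by rw [← h, Finsupp.cons_tail]
        exact Or.inl ⟨e.tail, by rwa [Set.mem_ofPred_eq, hc], hc⟩
      · have hc : e - Finsupp.single 0 1 + Finsupp.single 0 1 = e :=
          tsub_add_cancel_of_le (Finsupp.single_le_iff.2 h)
        exact Or.inr ⟨e - Finsupp.single 0 1, by rwa [Set.mem_ofPred_eq, hc], hc⟩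
    · rintro (⟨e, he, rfl⟩ | ⟨e, he, rfl⟩) <;> exact he
  · rw [Set.disjoint_left]
    rintro _ ⟨e, -, rfl⟩ ⟨e', -, h⟩
    simpa using DFunLike.congr_fun h 0

theorem degree_cons_zero {n : ℕ} (e : Fin n →₀ ℕ) : (Finsupp.cons 0 e).degree = e.degree := by
  simp [Finsupp.degree_eq_sum, Fin.sum_univ_succ]

theorem ncard_degree_eq (n i : ℕ) :
    {e : Fin (n + 1) →₀ ℕ | e.degree = i}.ncard = (i + n).choose n := by
  induction n generalizing i with
  | zero =>
    rw [add_zero, Nat.choose_zero_right, Set.ncard_eq_one]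
    refine ⟨Finsupp.single 0 i, ?_⟩
    ext e
    simp only [Finsupp.degree_eq_sum, Set.mem_ofPred_eq, Set.mem_singleton_iff]
    simp [Finsupp.ext_iff, Unique.forall_iff]
  | succ n ih =>
    induction i with
    | zero =>
      rw [zero_add, Nat.choose_self, Set.ncard_eq_one]
      exact ⟨0, by ext e; simp [Finsupp.degree_eq_zero_iff]⟩
    | succ i ihi =>
      rw [ncard_exponents_split (Finsupp.finite_of_degree_eq _)]
      simp only [Set.mem_ofPred_eq, degree_cons_zero, map_add, Finsupp.degree_single,
        add_left_inj]
      rw [ih, ihi, show i + 1 + (n + 1) = (i + n + 1) + 1 by ring, Nat.choose_succ_succ]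
      congr 2; ring

theorem lexExp_apply (n : ℕ) (a : ℕ → ℕ) (m : ℕ) (t : Fin (n + 1)) :
    lexExp n a m t = if (t : ℕ) < m then a (n - 1 - (t : ℕ))
      else if (t : ℕ) = m then (if m = n - 1 then a 0 else a (n - 1 - m) + 1)
      else 0 := rfl

theorem lexExp_congr {a a' : ℕ → ℕ} {n m : ℕ} (hm : m < n) (h : ∀ j < n, a j = a' j) :
    lexExp n a m = lexExp n a' m := by
  ext t
  rw [lexExp_apply, lexExp_apply, h (n - 1 - t) (by omega), h 0 (by omega),
    h (n - 1 - m) (by omega)]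

theorem lexStd_congr {a a' : ℕ → ℕ} {n : ℕ} (i : ℕ) (h : ∀ j < n, a j = a' j) :
    lexStd n a i = lexStd n a' i := by
  ext e
  refine and_congr_right fun _ => forall₂_congr fun m hm => ?_
  rw [lexExp_congr hm h]

theorem lexExp_update_top (n : ℕ) (a : ℕ → ℕ) (c m : ℕ) (hm : m < n + 1) :
    lexExp (n + 1) (Function.update a n (c + 1)) m =
      lexExp (n + 1) (Function.update a n c) m + Finsupp.single 0 1 := by
  ext t
  rw [Finsupp.add_apply, lexExp_apply, lexExp_apply, Finsupp.single_apply]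
  simp only [Function.update_apply, Fin.ext_iff, Fin.val_zero]
  split_ifs <;> first | rfl | omega

theorem lexExp_succ_top_zero (n : ℕ) (a : ℕ → ℕ) (ha : a (n + 1) = 0) (m : ℕ) :
    lexExp (n + 2) a (m + 1) = Finsupp.cons 0 (lexExp (n + 1) a m) := by
  ext t
  refine Fin.cases ?_ (fun t => ?_) t
  · simp [lexExp_apply, ha]
  · rw [Finsupp.cons_succ, lexExp_apply, lexExp_apply]
    have h1 : n + 2 - 1 - (t.succ : ℕ) = n + 1 - 1 - t := by simp
    have h2 : n + 2 - 1 - (m + 1) = n + 1 - 1 - m := by omega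
    rw [h1, h2]
    simp

theorem lexExp_top_zero (n : ℕ) (a : ℕ → ℕ) (ha : a (n + 1) = 0) :
    lexExp (n + 2) a 0 = Finsupp.single 0 1 := by
  ext t
  refine Fin.cases ?_ (fun t => ?_) t <;> simp [lexExp_apply, ha]

theorem cons_zero_le_cons_zero {n : ℕ} {e e' : Fin n →₀ ℕ} :
    Finsupp.cons 0 e ≤ Finsupp.cons 0 e' ↔ e ≤ e' := by
  simp [Finsupp.le_def, Fin.forall_fin_succ]

theorem ncard_lexStd_top_zero (n : ℕ) (a : ℕ → ℕ) (ha : a (n + 1) = 0) (i : ℕ) :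
    (lexStd (n + 2) a i).ncard = (lexStd (n + 1) a i).ncard := by
  rw [ncard_exponents_split (finite_lexStd _ _ _)]
  have h1 : {e : Fin (n + 3) →₀ ℕ | e + Finsupp.single 0 1 ∈ lexStd (n + 2) a i} = ∅ := by
    refine Set.eq_empty_of_forall_notMem fun e he => he.2 0 (by omega) ?_
    rw [lexExp_top_zero n a ha]
    exact le_add_self
  rw [h1, Set.ncard_empty, add_zero]
  congr 1
  ext e
  simp only [lexStd, Set.mem_ofPred_eq, degree_cons_zero]
  refine and_congr_right fun _ => ⟨fun h m hm hle => ?_, fun h m hm hle => ?_⟩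
  · refine h (m + 1) (by omega) ?_
    rwa [lexExp_succ_top_zero n a ha, cons_zero_le_cons_zero]
  · cases m with
    | zero =>
      rw [lexExp_top_zero n a ha, Finsupp.single_le_iff] at hle
      simp at hle
    | succ m =>
      rw [lexExp_succ_top_zero n a ha, cons_zero_le_cons_zero] at hle
      exact h m (by omega) hle

theorem ncard_lexStd_update_top (n : ℕ) (a : ℕ → ℕ) (c i : ℕ) :
    (lexStd (n + 1) (Function.update a n (c + 1)) (i + 1)).ncard =
      (i + 1 + n).choose n + (lexStd (n + 1) (Function.update a n c) i).ncard := by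
  rw [ncard_exponents_split (finite_lexStd _ _ _), ← ncard_degree_eq]
  congr 2
  · ext e
    simp only [lexStd, Set.mem_ofPred_eq, degree_cons_zero, and_iff_left_iff_imp]
    intro _ m hm hle
    have := hle 0
    rw [lexExp_update_top n a c m hm] at this
    simp at this
  · ext e
    simp only [lexStd, Set.mem_ofPred_eq, map_add, Finsupp.degree_single, add_left_inj]
    refine and_congr_right fun _ => forall₂_congr fun m hm => ?_
    rw [lexExp_update_top n a c m hm, add_le_add_iff_right]

theorem ncard_lexStd_eventually_of_zero (n : ℕ) (a : ℕ → ℕ)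
    (h0 : ∃ N : ℕ, ∀ i : ℕ, N ≤ i → ((lexStd (n + 1) (Function.update a n 0) i).ncard : ℚ) =
      (gotzmannPoly (lexPartition a n)).eval (i : ℚ)) (c : ℕ) :
    ∃ N : ℕ, ∀ i : ℕ, N ≤ i → ((lexStd (n + 1) (Function.update a n c) i).ncard : ℚ) =
      (gotzmannPoly (List.replicate c n ++ lexPartition a n)).eval (i : ℚ) := by
  induction c with
  | zero => simpa using h0
  | succ c ih =>
    obtain ⟨N, hN⟩ := ih
    refine ⟨N + 1, fun i hi => ?_⟩
    obtain ⟨i, rfl⟩ : ∃ i', i = i' + 1 := ⟨i - 1, by omega⟩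
    rw [ncard_lexStd_update_top, List.replicate_succ, List.cons_append, gotzmannPoly,
      Polynomial.eval_add, eval_polyBinom_natCast, Polynomial.taylor_eval, Nat.cast_add,
      hN i (by omega)]
    push_cast
    congr 2
    ring

theorem ncard_lexStd_eventually (n : ℕ) (a : ℕ → ℕ) :
    ∃ N : ℕ, ∀ i : ℕ, N ≤ i → ((lexStd (n + 1) a i).ncard : ℚ) =
      (gotzmannPoly (lexPartition a (n + 1))).eval (i : ℚ) := by
  induction n generalizing a with
  | zero =>
    have := ncard_lexStd_eventually_of_zero 0 a ⟨0, fun i _ => ?_⟩ (a 0)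
    · simpa [lexPartition] using this
    · have h : lexStd (0 + 1) (Function.update a 0 0) i = ∅ := by
        refine Set.eq_empty_of_forall_notMem fun e he => he.2 0 (by omega) fun t => ?_
        rw [lexExp_apply]
        simp
      rw [h]
      simp [lexPartition, gotzmannPoly]
  | succ n ih =>
    have := ncard_lexStd_eventually_of_zero (n + 1) a ?_ (a (n + 1))
    · simpa [lexPartition] using this
    · obtain ⟨N, hN⟩ := ih a
      refine ⟨N, fun i hi => ?_⟩
      rw [ncard_lexStd_top_zero _ _ (by simp), ← hN i hi,
        lexStd_congr (a' := a) i fun j hj => Function.update_of_ne (by omega) _ _]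

theorem lexExp_shift_of_lt (n : ℕ) (a : ℕ → ℕ) (m : ℕ) (hm : m + 1 < n) :
    lexExp (n + 1) (fun j => if j = 0 then 0 else a (j - 1)) m =
      (lexExp n a m).mapDomain Fin.castSucc := by
  ext t
  refine Fin.lastCases ?_ (fun t => ?_) t
  · rw [Finsupp.mapDomain_of_notMem_range _ _ (by simp), lexExp_apply,
      Fin.val_last, if_neg (by omega), if_neg (by omega)]
  · rw [Finsupp.mapDomain_apply (Fin.castSucc_injective _), lexExp_apply, lexExp_apply]
    simp only [Fin.val_castSucc]
    have h2 : n + 1 - 1 - m - 1 = n - 1 - m := by omega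
    have h3 : n + 1 - 1 - (t : ℕ) - 1 = n - 1 - t := by omega
    rw [h2, h3]
    split_ifs <;> first | rfl | omega

theorem lexExp_shift_last (n : ℕ) (a : ℕ → ℕ) :
    lexExp (n + 2) (fun j => if j = 0 then 0 else a (j - 1)) (n + 1) =
      (lexExp (n + 1) a n).mapDomain Fin.castSucc := by
  ext t
  refine Fin.lastCases ?_ (fun t => ?_) t
  · rw [Finsupp.mapDomain_of_notMem_range _ _ (by simp), lexExp_apply,
      Fin.val_last]
    simp
  · rw [Finsupp.mapDomain_apply (Fin.castSucc_injective _), lexExp_apply, lexExp_apply]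
    simp only [Fin.val_castSucc]
    have h3 : n + 2 - 1 - (t : ℕ) - 1 = n + 1 - 1 - t := by omega
    rw [h3]
    rcases lt_trichotomy (t : ℕ) n with h | h | h
    · rw [if_pos (by omega), if_neg (by omega), if_pos h]
    · rw [if_pos (by omega), if_neg (by omega), if_neg (by omega), if_pos h, h]
      simp
    · have ht : (t : ℕ) = n + 1 := by omega
      simp [ht]

theorem lexExp_shift_last_le (n : ℕ) (a : ℕ → ℕ) :
    lexExp (n + 2) (fun j => if j = 0 then 0 else a (j - 1)) (n + 1) ≤
      lexExp (n + 2) (fun j => if j = 0 then 0 else a (j - 1)) n := by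
  intro t
  rw [lexExp_apply, lexExp_apply]
  rcases lt_trichotomy (t : ℕ) n with h | h | h
  · rw [if_pos (by omega), if_pos h]
  · rw [if_pos (by omega), if_neg (by omega), if_pos h, if_neg (by omega), h]
    simp
  · rw [if_neg (by omega)]
    split_ifs <;> first | exact Nat.zero_le _ | omega

theorem map_rename_lexIdealGen (k : Type*) [Field k] (n : ℕ) (a : ℕ → ℕ) :
    Ideal.map (MvPolynomial.rename (Fin.castSucc : Fin (n + 2) → Fin (n + 3)))
        (lexIdealGen k (n + 1) a)
      = lexIdealGen k (n + 2) (fun j => if j = 0 then 0 else a (j - 1)) := by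
  rw [lexIdealGen, lexIdealGen, Ideal.map_span, Set.image_image]
  simp only [MvPolynomial.rename_monomial]
  apply le_antisymm
  · rw [Ideal.span_le]
    rintro _ ⟨m, hm, rfl⟩
    apply Ideal.subset_span
    rcases Nat.lt_or_ge m n with h | h
    · refine ⟨m, ?_, ?_⟩
      · simp only [Set.mem_ofPred_eq] at hm ⊢
        omega
      · dsimp only
        rw [lexExp_shift_of_lt _ _ _ (by omega)]
    · obtain rfl : m = n := by simp only [Set.mem_ofPred_eq] at hm; omega
      exact ⟨m + 1, by simp, by dsimp only; rw [lexExp_shift_last]⟩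
  · rw [Ideal.span_le]
    rintro _ ⟨m, hm, rfl⟩
    have hlast : MvPolynomial.monomial
        (lexExp (n + 2) (fun j => if j = 0 then 0 else a (j - 1)) (n + 1)) (1 : k) ∈
        Ideal.span ((fun m => MvPolynomial.monomial
          ((lexExp (n + 1) a m).mapDomain Fin.castSucc) (1 : k)) '' {m : ℕ | m < n + 1}) := by
      rw [lexExp_shift_last]
      exact Ideal.subset_span ⟨n, by simp, rfl⟩
    rcases lt_trichotomy m n with h | rfl | h
    · apply Ideal.subset_span
      refine ⟨m, ?_, ?_⟩
      · simp only [Set.mem_ofPred_eq]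
        omega
      · dsimp only
        rw [lexExp_shift_of_lt _ _ _ (by omega)]
    · refine Ideal.mem_of_dvd _ ?_ hlast
      exact MvPolynomial.monomial_dvd_monomial.2 ⟨Or.inr (lexExp_shift_last_le m a), dvd_rfl⟩
    · obtain rfl : m = n + 1 := by simp only [Set.mem_ofPred_eq] at hm; omega
      exact hlast

/-- Extending `L(a_0,…,a_{n−1}) ⊆ k[x_0,…,x_n]` to `k[x_0,…,x_{n+1}]` gives
`L(0,a_0,…,a_{n−1})`; moreover if the Hilbert polynomial of the quotient by
`L(a_0,…,a_{n−1})` has Gotzmann partition `(b_1,…,b_r)`, then the Hilbert polynomial of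
the quotient by `L(0,a_0,…,a_{n−1})` is `Σ_{j=1}^r C(t + (b_j+1) − (j−1), b_j+1)`. -/
theorem statement_7 (k : Type*) [Field k] (n d : ℕ) (hdn : d < n) (a : ℕ → ℕ) :
    Ideal.map (MvPolynomial.rename (Fin.castSucc : Fin (n + 1) → Fin (n + 2)))
        (lexIdealGen k n a)
      = lexIdealGen k (n + 1) (fun j => if j = 0 then 0 else a (j - 1)) ∧
    ∀ (r : ℕ) (b : Fin r → ℤ), Antitone b → (∀ j, 0 ≤ b j) →
      (∃ N : ℕ, ∀ i : ℕ, N ≤ i →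
        (hilbFn (lexIdealGen k n a) i : ℚ) = (gotzmannSum r b).eval (i : ℚ)) →
      (∃ N : ℕ, ∀ i : ℕ, N ≤ i →
        (hilbFn (lexIdealGen k (n + 1) (fun j => if j = 0 then 0 else a (j - 1))) i : ℚ)
          = (∑ j : Fin r, polyBinom (b j + 1 - ((j : ℕ) : ℤ)) (b j + 1)).eval (i : ℚ)) := by
  obtain ⟨n, rfl⟩ : ∃ n', n = n' + 1 := ⟨n - 1, by omega⟩
  refine ⟨map_rename_lexIdealGen k n a, ?_⟩
  rintro r b hb hb0 ⟨N, hN⟩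
  lift b to Fin r → ℕ using hb0
  obtain ⟨N₁, hN₁⟩ := ncard_lexStd_eventually n a
  obtain ⟨N₂, hN₂⟩ := ncard_lexStd_eventually (n + 1)
    (fun j => if j = 0 then 0 else a (j - 1))
  have hpoly : gotzmannPoly (List.ofFn b) = gotzmannPoly (lexPartition a (n + 1)) := by
    refine Polynomial.eq_of_infinite_eval_eq _ _
      (((Set.Ici_infinite (max N N₁)).image (Nat.cast_injective (R := ℚ)).injOn).mono ?_)
    rintro _ ⟨i, hi, rfl⟩
    rw [Set.mem_Ici, max_le_iff] at hi
    rw [Set.mem_ofPred_eq, ← hN₁ i hi.2, ← hilbFn_lexIdealGen k, hN i hi.1, gotzmannSum,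
      sum_polyBinom_eq_gotzmannPoly]
  have hlist : List.ofFn b = lexPartition a (n + 1) := by
    refine gotzmannPoly_injOn _ _ (List.pairwise_ofFn.2 fun i j hij => ?_)
      (lexPartition_pairwise _ _) hpoly
    exact Int.ofNat_le.1 (hb hij.le)
  refine ⟨N₂, fun i hi => ?_⟩
  rw [hilbFn_lexIdealGen, hN₂ i hi, lexPartition_shift, ← hlist, List.map_ofFn,
    ← sum_polyBinom_eq_gotzmannPoly]
  simp
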